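/- Let Z be a compact CAT(1) space of diameter π in which every point has an antipode, and suppose there exist points ξ, ξ̂ ∈ Z such that ξ is the unique antipode of ξ̂ in Z and ξ̂ is the unique antipode of ξ. If Z is the Tits boundary of a locally compact geodesically complete CAT(0) space X, then X splits off a line: X is isometric to R × X' for some CAT(0) space X'. -/

import Mathlib

open Real Set Filter Metric
open scoped ENNReal

noncomputable section

variable {X : Type*} [MetricSpace X]

/-- `γ` restricted to `[a,b]` is a unit-speed geodesic. -/
def IsGeodesicOn (γ : ℝ → X) (a b : ℝ) : Prop :=
  ∀ s ∈ Set.Icc a b, ∀ t ∈ Set.Icc a b, dist (γ s) (γ t) = |s - t|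

/-- A geodesic from `x` to `y` parametrized by arclength on `[0, dist x y]`. -/
def GeodesicBetween (γ : ℝ → X) (x y : X) : Prop :=
  γ 0 = x ∧ γ (dist x y) = y ∧ IsGeodesicOn γ 0 (dist x y)

/-- A complete geodesic (line). -/
def IsGeodesicLine (c : ℝ → X) : Prop := ∀ s t : ℝ, dist (c s) (c t) = |s - t|

/-- A geodesic ray (unit speed, defined on `[0,∞)`). -/
def IsGeodesicRay (c : ℝ → X) : Prop :=
  ∀ s t : ℝ, 0 ≤ s → 0 ≤ t → dist (c s) (c t) = |s - t|

/-- A CAT(0) space: geodesic and satisfying the CN (Bruhat–Tits) comparison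
inequality. -/
class CAT0 (X : Type*) [MetricSpace X] : Prop where
  geodesic : ∀ x y : X, ∃ γ : ℝ → X, GeodesicBetween γ x y
  cn : ∀ x y z m : X, dist y m = dist y z / 2 → dist z m = dist y z / 2 →
    dist x m ^ 2 ≤ (dist x y ^ 2 + dist x z ^ 2) / 2 - dist y z ^ 2 / 4

/-- Geodesic completeness: every nondegenerate geodesic segment extends to a complete
geodesic. -/
def GeodesicallyComplete (X : Type*) [MetricSpace X] : Prop :=
  ∀ (γ : ℝ → X) (x y : X), GeodesicBetween γ x y → x ≠ y →
    ∃ c : ℝ → X, IsGeodesicLine c ∧ ∀ t ∈ Set.Icc (0 : ℝ) (dist x y), c t = γ t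

/-- A *Hadamard space*: a locally compact, complete, geodesically complete CAT(0)
space. -/
def IsHadamard (X : Type*) [MetricSpace X] : Prop :=
  CAT0 X ∧ LocallyCompactSpace X ∧ CompleteSpace X ∧ GeodesicallyComplete X

/-- `X` has cocompact isometry group. -/
def CocompactIsom (X : Type*) [MetricSpace X] : Prop :=
  ∃ K : Set X, IsCompact K ∧ ∀ x : X, ∃ g : X ≃ᵢ X, g x ∈ K

/-- The space of geodesic rays of `X`. -/
def Ray (X : Type*) [MetricSpace X] := {c : ℝ → X // IsGeodesicRay c}

/-- Two rays are asymptotic if they are at bounded distance. -/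
def asymptotic (c c' : Ray X) : Prop :=
  ∃ K : ℝ, ∀ t : ℝ, 0 ≤ t → dist (c.1 t) (c'.1 t) ≤ K

def raySetoid (X : Type*) [MetricSpace X] : Setoid (Ray X) where
  r := asymptotic
  iseqv := by
    constructor
    · exact fun c => ⟨0, fun t _ => by simp⟩
    · rintro c c' ⟨K, hK⟩
      exact ⟨K, fun t ht => by rw [dist_comm]; exact hK t ht⟩
    · rintro c c' c'' ⟨K, hK⟩ ⟨K', hK'⟩
      exact ⟨K + K', fun t ht =>
        (dist_triangle _ (c'.1 t) _).trans (add_le_add (hK t ht) (hK' t ht))⟩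

/-- The ideal boundary `∂_∞ X`: asymptote classes of geodesic rays. -/
def IdealBoundary (X : Type*) [MetricSpace X] : Type _ := Quotient (raySetoid X)

/-- The ideal point determined by a geodesic ray. -/
def rayClass (c : Ray X) : IdealBoundary X := Quotient.mk (raySetoid X) c

/-- The forward ray of a complete geodesic. -/
def linePosRay (c : ℝ → X) (h : IsGeodesicLine c) : Ray X :=
  ⟨c, fun s t _ _ => h s t⟩

/-- The backward ray of a complete geodesic. -/
def lineNegRay (c : ℝ → X) (h : IsGeodesicLine c) : Ray X :=
  ⟨fun t => c (-t), fun s t _ _ => by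
    have := h (-s) (-t)
    rwa [show (-s) - (-t) = t - s by ring, abs_sub_comm] at this⟩

/-- The Tits angle between two ideal points: the limit of comparison angles between
representing rays issuing from a common basepoint. -/
noncomputable def titsAngle (ξ η : IdealBoundary X) : ℝ :=
  sSup {θ : ℝ | ∃ c c' : Ray X, rayClass c = ξ ∧ rayClass c' = η ∧ c.1 0 = c'.1 0 ∧
    Tendsto (fun t : ℝ => 2 * Real.arcsin (dist (c.1 t) (c'.1 t) / (2 * t)))
      atTop (nhds θ)}

/-- The length of a chain of ideal points, measured with the Tits angle. -/
noncomputable def chainLength (f : ℕ → IdealBoundary X) (n : ℕ) : ℝ≥0∞ :=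
  ∑ i ∈ Finset.range n, ENNReal.ofReal (titsAngle (f i) (f (i + 1)))

/-- The Tits metric on the ideal boundary: the intrinsic (length) metric associated to
the Tits angle, via infima over `ε`-fine chains. -/
noncomputable def titsDist (ξ η : IdealBoundary X) : ℝ≥0∞ :=
  ⨆ (ε : ℝ) (_ : 0 < ε), sInf {L : ℝ≥0∞ | ∃ (n : ℕ) (f : ℕ → IdealBoundary X),
    f 0 = ξ ∧ f n = η ∧ (∀ i < n, titsAngle (f i) (f (i + 1)) ≤ ε) ∧
    L = chainLength f n}

/-- Two ideal points are antipodal if their Tits distance is at least `π`. -/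
def AntipodalB (ξ η : IdealBoundary X) : Prop := ENNReal.ofReal π ≤ titsDist ξ η

/-- Two ideal points are visually antipodal if they are the two endpoints of a complete
geodesic in `X`. -/
def VisuallyAntipodal (ξ η : IdealBoundary X) : Prop :=
  ∃ (c : ℝ → X) (h : IsGeodesicLine c),
    rayClass (linePosRay c h) = ξ ∧ rayClass (lineNegRay c h) = η

/-- A subset of the ideal boundary is symmetric if it contains all antipodes of its
points. -/
def SymmetricSet (A : Set (IdealBoundary X)) : Prop :=
  ∀ ξ ∈ A, ∀ η, AntipodalB ξ η → η ∈ A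

/-- A subset of the ideal boundary is symmetric w.r.t. geodesic lines if every complete
geodesic of `X` has both or neither of its ideal endpoints in it. -/
def LineSymmetricSet (A : Set (IdealBoundary X)) : Prop :=
  ∀ (c : ℝ → X) (h : IsGeodesicLine c),
    (rayClass (linePosRay c h) ∈ A ↔ rayClass (lineNegRay c h) ∈ A)

/-- A subset is visually symmetric if it contains all visual antipodes of its points. -/
def VisuallySymmetricSet (A : Set (IdealBoundary X)) : Prop :=
  ∀ ξ ∈ A, ∀ η, VisuallyAntipodal ξ η → η ∈ A

/-- Convergence of a sequence of ideal points in the cone topology: representing rays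
from a common basepoint converge pointwise. -/
def ConeConvB (ξ : ℕ → IdealBoundary X) (η : IdealBoundary X) : Prop :=
  ∃ (c : ℕ → Ray X) (c' : Ray X), (∀ k, rayClass (c k) = ξ k) ∧ rayClass c' = η ∧
    (∀ k, (c k).1 0 = c'.1 0) ∧
    ∀ t : ℝ, 0 ≤ t → Tendsto (fun k => dist ((c k).1 t) (c'.1 t)) atTop (nhds 0)

/-- Sequential closure in the cone topology. -/
def coneClosure (A : Set (IdealBoundary X)) : Set (IdealBoundary X) :=
  A ∪ {η | ∃ ξ : ℕ → IdealBoundary X, (∀ k, ξ k ∈ A) ∧ ConeConvB ξ η}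

/-- Sequential closedness in the cone topology. -/
def ConeClosed (A : Set (IdealBoundary X)) : Prop :=
  ∀ (ξ : ℕ → IdealBoundary X) (η : IdealBoundary X),
    (∀ k, ξ k ∈ A) → ConeConvB ξ η → η ∈ A

/-- A minimal closed symmetric subset of the ideal boundary. -/
def MinimalClosedSymmetric (B : Set (IdealBoundary X)) : Prop :=
  B.Nonempty ∧ ConeClosed B ∧ SymmetricSet B ∧
    ∀ B' ⊆ B, B'.Nonempty → ConeClosed B' → SymmetricSet B' → B' = B

/-- Convergence of a sequence of points of `X` to an ideal point in the cone topology: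
the distances to a basepoint blow up and the geodesics from the basepoint converge
pointwise to a ray representing the ideal point. -/
def ConeConvPt (o : X) (x : ℕ → X) (η : IdealBoundary X) : Prop :=
  Tendsto (fun k => dist o (x k)) atTop atTop ∧
  ∃ (c : Ray X) (g : ℕ → ℝ → X), c.1 0 = o ∧ rayClass c = η ∧
    (∀ k, GeodesicBetween (g k) o (x k)) ∧
    ∀ t : ℝ, 0 ≤ t → Tendsto (fun k => dist (g k t) (c.1 t)) atTop (nhds 0)

/-- The image of a ray under an isometry of `X`. -/
def isomRay (g : X ≃ᵢ X) (c : Ray X) : Ray X :=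
  ⟨fun t => g (c.1 t), fun s t hs ht => by
    rw [g.dist_eq]; exact c.2 s t hs ht⟩

/-- The induced map of an isometry of `X` on the ideal boundary. -/
def isomBoundary (g : X ≃ᵢ X) : IdealBoundary X → IdealBoundary X :=
  Quotient.map' (isomRay g) (by
    rintro c c' ⟨K, hK⟩
    exact ⟨K, fun t ht => by simpa [isomRay, g.dist_eq] using hK t ht⟩)

/-- A submetry from the Tits boundary to a metric space. -/
def IsTitsSubmetry {Δ : Type*} [MetricSpace Δ] (δ : IdealBoundary X → Δ) : Prop :=
  Function.Surjective δ ∧ ∀ (ξ : IdealBoundary X) (r : ℝ), 0 ≤ r →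
    δ '' {η | titsDist ξ η ≤ ENNReal.ofReal r} = Metric.closedBall (δ ξ) r

open scoped RealInnerProductSpace

/-- Spherical (angular) distance between vectors. -/
noncomputable def sd {m : ℕ} (u v : EuclideanSpace ℝ (Fin m)) : ℝ := Real.arccos ⟪u, v⟫

/-- A subset of the Tits boundary is a round `k`-sphere if it admits a distance chart
onto the unit sphere `S^k ⊂ ℝ^{k+1}`. -/
def IsRoundSphereB (S : Set (IdealBoundary X)) (k : ℕ) : Prop :=
  ∃ f : IdealBoundary X → EuclideanSpace ℝ (Fin (k + 1)),
    (∀ p ∈ S, ‖f p‖ = 1) ∧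
    (∀ v : EuclideanSpace ℝ (Fin (k + 1)), ‖v‖ = 1 → ∃ p ∈ S, f p = v) ∧
    Set.InjOn f S ∧
    ∀ p ∈ S, ∀ q ∈ S, titsDist p q = ENNReal.ofReal (sd (f p) (f q))

/-- A round sphere of the Tits boundary is top-dimensional if no round sphere of larger
dimension exists. -/
def IsTopDimSphere (S : Set (IdealBoundary X)) (k : ℕ) : Prop :=
  IsRoundSphereB S k ∧ ∀ (S' : Set (IdealBoundary X)) (m : ℕ), IsRoundSphereB S' m → m ≤ k

/-- A subset `H` of the Tits boundary is a round `k`-hemisphere with boundary sphere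
`bd` if it admits a distance chart onto a closed hemisphere of `S^k`, carrying `bd`
onto the equator. -/
def IsRoundHemisphereB (H : Set (IdealBoundary X)) (k : ℕ) (bd : Set (IdealBoundary X)) :
    Prop :=
  ∃ f : IdealBoundary X → EuclideanSpace ℝ (Fin (k + 1)),
    (∀ p ∈ H, ‖f p‖ = 1 ∧ 0 ≤ f p (Fin.last k)) ∧
    (∀ v : EuclideanSpace ℝ (Fin (k + 1)), ‖v‖ = 1 → 0 ≤ v (Fin.last k) →
      ∃ p ∈ H, f p = v) ∧
    Set.InjOn f H ∧
    (∀ p ∈ H, ∀ q ∈ H, titsDist p q = ENNReal.ofReal (sd (f p) (f q))) ∧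
    bd = {p ∈ H | f p (Fin.last k) = 0}


/-! ### Helper lemmas -/

lemma convexOn_of_mid (S : Set ℝ) (hS : Convex ℝ S) (f : ℝ → ℝ) (hc : ContinuousOn f S)
    (hm : ∀ s ∈ S, ∀ t ∈ S, f ((s + t) / 2) ≤ (f s + f t) / 2) : ConvexOn ℝ S f := by
  refine ⟨hS, ?_⟩
  intro x hx y hy a b ha hb hab
  -- the function along the segment minus interpolation
  set g : ℝ → ℝ := fun t => f ((1 - t) * x + t * y) - ((1 - t) * f x + t * f y) with hg
  have hmem : ∀ t ∈ Icc (0:ℝ) 1, (1 - t) * x + t * y ∈ S := by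
    intro t ht
    have := hS hx hy (a := 1 - t) (b := t) (by linarith [ht.2]) ht.1 (by ring)
    simpa using this
  have hgc : ContinuousOn g (Icc 0 1) := by
    apply ContinuousOn.sub
    · exact hc.comp (by fun_prop) hmem
    · fun_prop
  have hgm : ∀ s ∈ Icc (0:ℝ) 1, ∀ t ∈ Icc (0:ℝ) 1, g ((s + t) / 2) ≤ (g s + g t) / 2 := by
    intro s hs t ht
    have := hm _ (hmem s hs) _ (hmem t ht)
    rw [show ((1 - s) * x + s * y + ((1 - t) * x + t * y)) / 2
      = (1 - (s + t) / 2) * x + (s + t) / 2 * y by ring] at this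
    simp only [hg]
    linarith
  have hg0 : g 0 = 0 := by simp [hg]
  have hg1 : g 1 = 0 := by simp [hg]
  have key : ∀ t ∈ Icc (0:ℝ) 1, g t ≤ 0 := by
    by_contra! hcon
    obtain ⟨t0, ht0, hpos⟩ := hcon
    obtain ⟨m, hmI, hmax⟩ := isCompact_Icc.exists_isMaxOn ⟨t0, ht0⟩ hgc
    have hM : 0 < g m := lt_of_lt_of_le hpos (hmax ht0)
    have hKc : IsCompact (Icc (0:ℝ) 1 ∩ g ⁻¹' {g m}) :=
      isCompact_Icc.of_isClosed_subset (hgc.preimage_isClosed_of_isClosed isClosed_Icc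
        isClosed_singleton) inter_subset_left
    obtain ⟨u, hu⟩ := hKc.exists_isLeast ⟨m, hmI, rfl⟩
    have hug : g u = g m := hu.1.2
    have hu0 : 0 < u := by
      rcases hu.1.1.1.eq_or_lt with h | h
      · rw [← h, hg0] at hug; linarith
      · exact h
    have hu1 : u < 1 := by
      rcases hu.1.1.2.eq_or_lt with h | h
      · rw [h, hg1] at hug; linarith
      · exact h
    set d := min u (1 - u)
    have hd : 0 < d := lt_min hu0 (by linarith)
    have hd1 : d ≤ u := min_le_left _ _
    have hd2 : d ≤ 1 - u := min_le_right _ _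
    have h1 : u - d ∈ Icc (0:ℝ) 1 := ⟨by linarith, by linarith⟩
    have h2 : u + d ∈ Icc (0:ℝ) 1 := ⟨by linarith, by linarith⟩
    have h3 := hgm _ h1 _ h2
    rw [show (u - d + (u + d)) / 2 = u by ring] at h3
    have h4 : g (u + d) ≤ g m := hmax h2
    have h5 : g (u - d) ≤ g m := hmax h1
    have h6 : g (u - d) ≠ g m := fun h => by
      have := hu.2 ⟨h1, h⟩
      linarith
    have h7 := lt_of_le_of_ne h5 h6
    linarith
  have := key b ⟨hb, by linarith⟩
  simp only [hg] at this
  have ha' : a = 1 - b := by linarith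
  subst ha'
  simpa using this

/-- midpoints in a triangle -/
lemma cat0_mid_tri [CAT0 X] (p x y m n : X) (h1 : dist p m = dist p x / 2)
    (h2 : dist x m = dist p x / 2) (h3 : dist p n = dist p y / 2) (h4 : dist y n = dist p y / 2) :
    dist m n ≤ dist x y / 2 := by
  have a1 := CAT0.cn m p y n h3 h4
  have a2 := CAT0.cn y p x m h1 h2
  rw [dist_comm m p, h1, dist_comm m y] at a1
  rw [dist_comm y p, dist_comm y x] at a2
  apply le_of_sq_le_sq _ (by positivity)
  nlinarith

lemma exists_mid [CAT0 X] (x y : X) : ∃ m, dist x m = dist x y / 2 ∧ dist y m = dist x y / 2 := by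
  obtain ⟨γ, h0, h1, h⟩ := CAT0.geodesic x y
  have hd : 0 ≤ dist x y := dist_nonneg
  refine ⟨γ (dist x y / 2), ?_, ?_⟩
  · have := h 0 ⟨le_rfl, hd⟩ (dist x y / 2) ⟨by linarith, by linarith⟩
    rw [h0] at this
    rw [this, zero_sub, abs_neg, abs_of_nonneg (by linarith)]
  · have := h (dist x y) ⟨hd, le_rfl⟩ (dist x y / 2) ⟨by linarith, by linarith⟩
    rw [h1] at this
    rw [this, abs_of_nonneg (by linarith)]; ring

lemma cat0_mid_mid [CAT0 X] (x y x' y' m m' : X) (h1 : dist x m = dist x y / 2)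
    (h2 : dist y m = dist x y / 2) (h3 : dist x' m' = dist x' y' / 2)
    (h4 : dist y' m' = dist x' y' / 2) :
    dist m m' ≤ (dist x x' + dist y y') / 2 := by
  obtain ⟨n, hn1, hn2⟩ := exists_mid x y'
  have a := cat0_mid_tri x y y' m n h1 h2 hn1 hn2
  have b := cat0_mid_tri y' x x' n m' (by rw [hn2, dist_comm x]) (by rw [hn1, dist_comm x])
    (by rw [h4, dist_comm x']) (by rw [h3, dist_comm x'])
  linarith [dist_triangle m n m']

/-- quadrilateral inequality -/
lemma cat0_quad [CAT0 X] (x y z w : X) :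
    dist x z ^ 2 + dist y w ^ 2 ≤ dist x y ^ 2 + dist y z ^ 2 + dist z w ^ 2 + dist w x ^ 2 := by
  obtain ⟨m, h1, h2⟩ := exists_mid x z
  have a := CAT0.cn y x z m h1 h2
  have b := CAT0.cn w x z m h1 h2
  have c := dist_triangle y m w
  rw [dist_comm m w] at c
  rw [dist_comm y x] at a
  rw [dist_comm w z] at b
  have hy : 0 ≤ dist y w := dist_nonneg
  nlinarith [sq_nonneg (dist y m - dist w m)]

lemma continuousOn_of_speed (S : Set ℝ) (γ : ℝ → X) (a : ℝ)
    (hγ : ∀ s ∈ S, ∀ t ∈ S, dist (γ s) (γ t) = a * |s - t|) : ContinuousOn γ S := by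
  intro s hs
  rw [ContinuousWithinAt, tendsto_iff_dist_tendsto_zero]
  have h1 : Tendsto (fun t => a * |t - s|) (nhdsWithin s S) (nhds 0) := by
    have : Continuous fun t : ℝ => a * |t - s| := by fun_prop
    have h := (this.tendsto s).mono_left (nhdsWithin_le_nhds (s := S))
    simpa using h
  refine h1.congr' ?_
  filter_upwards [self_mem_nhdsWithin] with t ht
  exact (hγ t ht s hs).symm

lemma mid_of_speed (S : Set ℝ) (hS : Convex ℝ S) (γ : ℝ → X) (a : ℝ)
    (hγ : ∀ s ∈ S, ∀ t ∈ S, dist (γ s) (γ t) = a * |s - t|) (s t : ℝ) (hs : s ∈ S) (ht : t ∈ S) :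
    (s + t) / 2 ∈ S ∧ dist (γ s) (γ ((s + t) / 2)) = dist (γ s) (γ t) / 2 ∧
    dist (γ t) (γ ((s + t) / 2)) = dist (γ s) (γ t) / 2 := by
  have hm : (s + t) / 2 ∈ S := by
    have := hS hs ht (a := 1 / 2) (b := 1 / 2) (by norm_num) (by norm_num) (by norm_num)
    simp only [smul_eq_mul] at this
    convert this using 1; ring
  refine ⟨hm, ?_, ?_⟩
  · rw [hγ s hs _ hm, hγ s hs t ht, show s - (s + t) / 2 = (s - t) / 2 by ring, abs_div, abs_two]
    ring
  · rw [hγ t ht _ hm, hγ s hs t ht, show t - (s + t) / 2 = -((s - t) / 2) by ring, abs_neg,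
      abs_div, abs_two]
    ring

lemma cat0_convexOn_dist [CAT0 X] (S : Set ℝ) (hS : Convex ℝ S) (γ γ' : ℝ → X) (a b : ℝ)
    (hγ : ∀ s ∈ S, ∀ t ∈ S, dist (γ s) (γ t) = a * |s - t|)
    (hγ' : ∀ s ∈ S, ∀ t ∈ S, dist (γ' s) (γ' t) = b * |s - t|) :
    ConvexOn ℝ S (fun t => dist (γ t) (γ' t)) := by
  apply convexOn_of_mid S hS
  · exact continuous_dist.comp_continuousOn ((continuousOn_of_speed S γ a hγ).prodMk
      (continuousOn_of_speed S γ' b hγ'))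
  · intro s hs t ht
    obtain ⟨_, h1, h2⟩ := mid_of_speed S hS γ a hγ s t hs ht
    obtain ⟨_, h3, h4⟩ := mid_of_speed S hS γ' b hγ' s t hs ht
    exact cat0_mid_mid _ _ _ _ _ _ h1 h2 h3 h4

lemma convexOn_sq [CAT0 X] (S : Set ℝ) (hS : Convex ℝ S) (γ : ℝ → X) (p : X)
    (hγ : ∀ s ∈ S, ∀ t ∈ S, dist (γ s) (γ t) = |s - t|) :
    ConvexOn ℝ S (fun t => dist p (γ t) ^ 2 - t ^ 2) := by
  have hγ' : ∀ s ∈ S, ∀ t ∈ S, dist (γ s) (γ t) = 1 * |s - t| := by simpa using hγ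
  apply convexOn_of_mid S hS
  · have := continuousOn_of_speed S γ 1 hγ'
    fun_prop
  · intro s hs t ht
    obtain ⟨_, h1, h2⟩ := mid_of_speed S hS γ 1 hγ' s t hs ht
    have := CAT0.cn p _ _ _ h1 h2
    rw [hγ s hs t ht, sq_abs] at this
    nlinarith

lemma exists_between_pt [CAT0 X] (x y : X) (r δ : ℝ) (hr : 0 ≤ r) (hδ : 0 ≤ δ)
    (h : dist x y ≤ r + δ) : ∃ z, dist x z ≤ r ∧ dist z y ≤ δ := by
  by_cases hc : dist x y ≤ r
  · exact ⟨y, hc, by simpa⟩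
  · push Not at hc
    obtain ⟨γ, h0, h1, hg⟩ := CAT0.geodesic x y
    refine ⟨γ r, ?_, ?_⟩
    · have := hg 0 ⟨le_rfl, by linarith⟩ r ⟨hr, hc.le⟩
      rw [h0] at this
      rw [this, zero_sub, abs_neg, abs_of_nonneg hr]
    · have := hg r ⟨hr, hc.le⟩ (dist x y) ⟨by linarith, le_rfl⟩
      rw [h1] at this
      rw [this, abs_of_nonpos (by linarith)]; linarith

/-- Hopf–Rinow -/
lemma cat0_proper [CAT0 X] [LocallyCompactSpace X] [CompleteSpace X] : ProperSpace X := by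
  refine ⟨fun x0 r => ?_⟩
  by_contra hr
  set S : Set ℝ := {s | 0 ≤ s ∧ IsCompact (closedBall x0 s)} with hS
  have h0 : (0:ℝ) ∈ S := ⟨le_rfl, by simp⟩
  have hb : ∀ s ∈ S, s ≤ r := by
    intro s hs
    by_contra! hlt
    exact hr (hs.2.of_isClosed_subset isClosed_closedBall (closedBall_subset_closedBall hlt.le))
  have hbdd : BddAbove S := ⟨r, hb⟩
  set R := sSup S
  have hR0 : 0 ≤ R := le_csSup hbdd h0
  have hRc : IsCompact (closedBall x0 R) := by
    rw [isCompact_iff_totallyBounded_isComplete]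
    refine ⟨?_, isClosed_closedBall.isComplete⟩
    rw [Metric.totallyBounded_iff]
    intro ε hε
    obtain ⟨s, hs, hsR⟩ := exists_lt_of_lt_csSup ⟨0, h0⟩ (show R - ε / 2 < R by linarith)
    obtain ⟨t, htf, ht⟩ := Metric.totallyBounded_iff.1 hs.2.totallyBounded (ε / 2) (by linarith)
    refine ⟨t, htf, ?_⟩
    intro y hy
    rw [mem_closedBall, dist_comm] at hy
    obtain ⟨z, hz1, hz2⟩ := exists_between_pt x0 y s (ε / 2) hs.1 (by linarith) (by linarith)
    have hz : z ∈ closedBall x0 s := by rwa [mem_closedBall, dist_comm]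
    have hz' := ht hz
    simp only [mem_iUnion, mem_ball] at hz' ⊢
    obtain ⟨i, hi, hzi⟩ := hz'
    refine ⟨i, hi, ?_⟩
    rw [dist_comm] at hz2
    linarith [dist_triangle y z i]
  obtain ⟨K, hK, hKs⟩ := exists_compact_superset hRc
  obtain ⟨δ, hδ, hsub⟩ := hRc.exists_cthickening_subset_open isOpen_interior hKs
  have : R + δ ∈ S := by
    refine ⟨by linarith, hK.of_isClosed_subset isClosed_closedBall ?_⟩
    refine Subset.trans ?_ (hsub.trans interior_subset)
    intro y hy
    rw [mem_closedBall, dist_comm] at hy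
    obtain ⟨z, hz1, hz2⟩ := exists_between_pt x0 y R δ hR0 hδ.le hy
    exact mem_cthickening_of_dist_le y z δ _ (by rwa [mem_closedBall, dist_comm])
      (by rwa [dist_comm])
  linarith [le_csSup hbdd this]

lemma small_of_proper [ProperSpace X] : Small.{0} X := by
  rcases isEmpty_or_nonempty X with h | h
  · infer_instance
  · apply small_of_injective (β := ℕ → ℝ)
      (f := fun y n => dist y (TopologicalSpace.denseSeq X n))
    intro y z hyz
    by_contra hne
    have hpos := dist_pos.2 hne
    obtain ⟨w, hw⟩ := (TopologicalSpace.denseRange_denseSeq X).exists_dist_lt y (half_pos hpos)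
    have h1 := congrFun hyz w
    simp only at h1
    linarith [dist_triangle_right y z (TopologicalSpace.denseSeq X w)]

lemma affine_of_mid (h : ℝ → ℝ) (hc : Continuous h) (hm : ∀ s a, h (s + a) + h (s - a) = 2 * h s) :
    ∀ a, h a = h 0 + a * (h 1 - h 0) := by
  have hadd : ∀ x y, h (x + y) - h 0 = (h x - h 0) + (h y - h 0) := by
    intro x y
    have h1 := hm ((x + y) / 2) ((x + y) / 2)
    have h2 := hm ((x + y) / 2) ((x - y) / 2)
    rw [show (x + y) / 2 + (x + y) / 2 = x + y by ring, sub_self] at h1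
    rw [show (x + y) / 2 + (x - y) / 2 = x by ring,
      show (x + y) / 2 - (x - y) / 2 = y by ring] at h2
    linarith
  let k : ℝ →+ ℝ := AddMonoidHom.mk' (fun x => h x - h 0) hadd
  intro a
  have := map_real_smul k (show Continuous fun x => h x - h 0 by fun_prop) a 1
  simp only [smul_eq_mul, mul_one] at this
  have h2 : h a - h 0 = a * (h 1 - h 0) := this
  linarith

lemma flow_quadratic [CAT0 X] (φ : ℝ → X → X) (h0 : ∀ x, φ 0 x = x)
    (hadd : ∀ s t x, φ (s + t) x = φ s (φ t x))
    (hiso : ∀ t x y, dist (φ t x) (φ t y) = dist x y)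
    (hline : ∀ t x, dist x (φ t x) = |t|) (x y : X) :
    ∃ β : ℝ, ∀ a, dist (φ a x) y ^ 2 = a ^ 2 + 2 * a * β + dist x y ^ 2 := by
  have hl : ∀ s ∈ (univ : Set ℝ), ∀ t ∈ (univ : Set ℝ), dist (φ s x) (φ t x) = |s - t| := by
    intro s _ t _
    have : φ s x = φ t (φ (s - t) x) := by rw [← hadd]; congr 1; ring
    rw [this, hiso, dist_comm, hline]
  have hconv := convexOn_sq univ convex_univ (fun t => φ t x) y hl
  have hcv := hconv.2
  have hcont : Continuous (fun t => φ t x) := by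
    rw [← continuousOn_univ]
    exact continuousOn_of_speed univ _ 1 (by simpa using hl)
  set h : ℝ → ℝ := fun t => dist y (φ t x) ^ 2 - t ^ 2 with hh
  have hc : Continuous h := by fun_prop
  have hm : ∀ s a, h (s + a) + h (s - a) = 2 * h s := by
    intro s a
    apply le_antisymm
    · -- use the parallelogram based at φ s x
      have q := cat0_quad (φ s x) (φ (s + a) x) (φ a y) y
      have e5 : dist (φ s x) (φ a y) = dist y (φ (s - a) x) := by
        rw [← hiso (-a), ← hadd, ← hadd, neg_add_cancel, h0, dist_comm]; congr 2; ring
      have e6 : dist (φ s x) (φ (s + a) x) = |a| := by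
        rw [hl _ trivial _ trivial, abs_sub_comm]; congr 1; ring
      have e7 : dist (φ (s + a) x) (φ a y) = dist y (φ s x) := by
        rw [show s + a = a + s by ring, hadd, hiso, dist_comm]
      have e8 : dist (φ a y) y = |a| := by rw [dist_comm, hline]
      rw [e5, dist_comm _ y, e6, e7, e8, sq_abs] at q
      simp only [hh]
      nlinarith
    · have := hcv (mem_univ (s + a)) (mem_univ (s - a)) (a := 1 / 2) (b := 1 / 2)
        (by norm_num) (by norm_num) (by norm_num)
      simp only [smul_eq_mul] at this
      rw [show 1 / 2 * (s + a) + 1 / 2 * (s - a) = s by ring] at this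
      simp only [hh]
      linarith
  have hA := affine_of_mid h hc hm
  refine ⟨(h 1 - h 0) / 2, fun a => ?_⟩
  have := hA a
  have e0 : h 0 = dist x y ^ 2 := by simp [hh, h0, dist_comm]
  have ea : h a = dist (φ a x) y ^ 2 - a ^ 2 := by simp [hh, dist_comm]
  rw [ea] at this
  rw [show dist (φ a x) y ^ 2 = h 0 + a * (h 1 - h 0) + a ^ 2 by linarith, ← e0]
  ring

lemma split_of_flow [CAT0 X] [Small.{0} X] [Nonempty X] (φ : ℝ → X → X) (h0 : ∀ x, φ 0 x = x)
    (hadd : ∀ s t x, φ (s + t) x = φ s (φ t x))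
    (hiso : ∀ t x y, dist (φ t x) (φ t y) = dist x y)
    (hline : ∀ t x, dist x (φ t x) = |t|) :
    ∃ (X' : Type) (_ : MetricSpace X') (_ : CAT0 X') (f : X → ℝ × X'),
      Function.Bijective f ∧
        ∀ x y : X, dist x y ^ 2 =
          (dist (f x).1 (f y).1) ^ 2 + (dist (f x).2 (f y).2) ^ 2 := by
  choose β hβ using flow_quadratic φ h0 hadd hiso hline
  obtain ⟨x0⟩ := ‹Nonempty X›
  have uniq : ∀ (x y : X) (b : ℝ), (∀ a, dist (φ a x) y ^ 2 = a ^ 2 + 2 * a * b + dist x y ^ 2) →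
      β x y = b := by
    intro x y b h
    have h1 := h 1
    have h2 := hβ x y 1
    linarith
  have hshift : ∀ s x y, β (φ s x) y = β x y + s := by
    intro s x y
    apply uniq
    intro a
    rw [← hadd, hβ, hβ x y s]
    ring
  have hanti : ∀ x y, β y x = - β x y := by
    intro x y
    apply uniq
    intro a
    have := hβ x y (-a)
    rw [← hiso a, ← hadd, add_neg_cancel, h0, dist_comm] at this
    rw [this, dist_comm y x]; ring
  have hE : ∀ x y, 0 ≤ dist x y ^ 2 - β x y ^ 2 := by
    intro x y
    have := hβ x y (- β x y)
    nlinarith [sq_nonneg (dist (φ (-β x y) x) y)]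
  have hcoc : ∀ x y z, β x z = β x y + β y z := by
    intro x y z
    set E1 := dist x y ^ 2 - β x y ^ 2 with hE1
    set E2 := dist y z ^ 2 - β y z ^ 2 with hE2
    set κ := β x z - β x y - β y z with hκ
    have key : ∀ u : ℝ, 4 * u * κ + κ ^ 2 ≤ 2 * (E1 + E2) := by
      intro u
      have t := dist_triangle (φ (2 * u - β x y - β y z) x) (φ (u - β y z) y) z
      have e1 : dist (φ (2 * u - β x y - β y z) x) (φ (u - β y z) y)
          = dist (φ (u - β x y) x) y := by
        rw [show 2 * u - β x y - β y z = (u - β y z) + (u - β x y) by ring, hadd, hiso]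
      rw [e1] at t
      have a1 := hβ x z (2 * u - β x y - β y z)
      have a2 := hβ x y (u - β x y)
      have a3 := hβ y z (u - β y z)
      have a4 := hE x z
      set P := dist (φ (2 * u - β x y - β y z) x) z
      set Q := dist (φ (u - β x y) x) y
      set R := dist (φ (u - β y z) y) z
      have hP : 0 ≤ P := dist_nonneg
      have b1 : P ^ 2 ≤ 2 * Q ^ 2 + 2 * R ^ 2 := by nlinarith [sq_nonneg (Q - R)]
      have b2 : Q ^ 2 = u ^ 2 + E1 := by rw [a2, hE1]; ring
      have b3 : R ^ 2 = u ^ 2 + E2 := by rw [a3, hE2]; ring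
      have b4 : P ^ 2 = (2 * u + κ) ^ 2 + (dist x z ^ 2 - β x z ^ 2) := by rw [a1, hκ]; ring
      nlinarith
    have hκ0 : κ = 0 := by
      by_contra hne
      have := key ((2 * (E1 + E2) + 1) / (4 * κ))
      rw [show 4 * ((2 * (E1 + E2) + 1) / (4 * κ)) * κ = 2 * (E1 + E2) + 1 by field_simp] at this
      nlinarith [sq_nonneg κ]
    linarith
  let B : X → ℝ := fun y => β y x0
  have hB : ∀ s y, B (φ s y) = B y + s := fun s y => hshift s y x0
  have hββ : ∀ x y, β x y = B x - B y := by
    intro x y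
    have h1 := hcoc x y x0
    simp only [B]; linarith
  let pr : X → X := fun x => φ (- B x) x
  have hpr : ∀ x, B (pr x) = 0 := by intro x; simp only [pr, hB]; ring
  have hprs : ∀ s x, pr (φ s x) = pr x := by
    intro s x
    simp only [pr, hB]; rw [← hadd]; congr 1; ring
  have hprid : ∀ x, B x = 0 → pr x = x := by
    intro x hx; simp only [pr, hx, neg_zero, h0]
  have hpyth : ∀ x y, dist x y ^ 2 = (B x - B y) ^ 2 + dist (pr x) (pr y) ^ 2 := by
    intro x y
    have h1 := hβ (pr x) (pr y) (B x - B y)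
    rw [hββ, hpr, hpr] at h1
    have h2 : dist (φ (B x - B y) (pr x)) (pr y) = dist x y := by
      simp only [pr]
      rw [← hadd, ← hiso (B y), ← hadd, ← hadd, show B y + -B y = 0 by ring, h0,
        show B y + (B x - B y + -B x) = 0 by ring, h0]
    rw [h2] at h1
    rw [h1]; ring
  have hlip : ∀ x y, dist (pr x) (pr y) ≤ dist x y := by
    intro x y
    apply le_of_sq_le_sq _ dist_nonneg
    nlinarith [hpyth x y, sq_nonneg (B x - B y)]
  let Y := {x : X // B x = 0}
  let e : Shrink.{0} Y ≃ Y := (equivShrink Y).symm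
  let mX' : MetricSpace (Shrink.{0} Y) := MetricSpace.induced e e.injective inferInstance
  have hd : ∀ u v : Shrink.{0} Y, dist u v = dist (e u).1 (e v).1 := fun u v => rfl
  refine ⟨Shrink.{0} Y, mX', ?_, fun x => (B x, e.symm ⟨pr x, hpr x⟩), ?_, ?_⟩
  · constructor
    · intro u v
      obtain ⟨γ, g0, g1, hg⟩ := CAT0.geodesic (e u).1 (e v).1
      refine ⟨fun t => e.symm ⟨pr (γ t), hpr _⟩, ?_, ?_, ?_⟩
      · apply e.injective
        apply Subtype.ext
        simp [g0, hprid _ (e u).2]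
      · apply e.injective
        apply Subtype.ext
        simp [hd, g1, hprid _ (e v).2]
      · rw [hd]
        have main : ∀ s ∈ Icc 0 (dist (e u).1 (e v).1), ∀ t ∈ Icc 0 (dist (e u).1 (e v).1), s ≤ t →
            dist (pr (γ s)) (pr (γ t)) = |s - t| := by
          intro s hs t ht hst
          have hD : (0:ℝ) ≤ dist (e u).1 (e v).1 := dist_nonneg
          apply le_antisymm
          · rw [← hg s hs t ht]; exact hlip _ _
          · have l1 := hlip (γ 0) (γ s)
            have l2 := hlip (γ t) (γ (dist (e u).1 (e v).1))
            rw [hg 0 ⟨le_rfl, hD⟩ s hs, g0, hprid _ (e u).2] at l1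
            rw [hg t ht _ ⟨hD, le_rfl⟩, g1, hprid _ (e v).2] at l2
            have l3 := dist_triangle4 (e u).1 (pr (γ s)) (pr (γ t)) (e v).1
            rw [zero_sub, abs_neg, abs_of_nonneg hs.1] at l1
            rw [abs_of_nonpos (by linarith [ht.2])] at l2
            rw [abs_of_nonpos (by linarith)]
            linarith
        intro s hs t ht
        rw [hd]
        simp only [Equiv.apply_symm_apply]
        rcases le_total s t with h | h
        · exact main s hs t ht h
        · rw [dist_comm, abs_sub_comm]; exact main t ht s hs h
    · intro x y z m h1 h2
      simp only [hd] at *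
      exact CAT0.cn _ _ _ _ h1 h2
  · constructor
    · intro x y hxy
      simp only [Prod.mk.injEq, EmbeddingLike.apply_eq_iff_eq] at hxy
      have hxy2 : pr x = pr y := congrArg Subtype.val hxy.2
      have := hpyth x y
      rw [hxy.1, hxy2] at this
      simpa using this
    · rintro ⟨s, u⟩
      refine ⟨φ s (e u).1, ?_⟩
      have hu := (e u).2
      simp only [Prod.mk.injEq]
      refine ⟨by rw [hB, hu, zero_add], ?_⟩
      rw [Equiv.symm_apply_eq]
      apply Subtype.ext
      simp only [hprs, hprid _ hu]
  · intro x y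
    simp only [hd, Equiv.apply_symm_apply]
    rw [hpyth x y, Real.dist_eq, sq_abs]

lemma exists_ray_from [CAT0 X] [ProperSpace X] (c : Ray X) (x : X) :
    ∃ c' : Ray X, c'.1 0 = x ∧ rayClass c' = rayClass c := by
  set D := dist x (c.1 0) with hD
  have hD0 : 0 ≤ D := dist_nonneg
  choose γ hγ using fun n : ℕ => CAT0.geodesic x (c.1 n)
  have hL1 : ∀ n : ℕ, dist x (c.1 n) ≤ n + D := by
    intro n
    have h1 := dist_triangle x (c.1 0) (c.1 n)
    rw [c.2 0 n le_rfl (Nat.cast_nonneg n), zero_sub, abs_neg, abs_of_nonneg (Nat.cast_nonneg n)]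
      at h1
    linarith
  have hL2 : ∀ n : ℕ, (n:ℝ) - D ≤ dist x (c.1 n) := by
    intro n
    have h1 := dist_triangle_left (c.1 0) (c.1 n) x
    rw [c.2 0 n le_rfl (Nat.cast_nonneg n), zero_sub, abs_neg, abs_of_nonneg (Nat.cast_nonneg n)]
      at h1
    linarith
  have hbound : ∀ (t : ℝ) (n : ℕ), 0 ≤ t → t + D + 1 ≤ n → dist (γ n t) (c.1 t) ≤ 2 * D := by
    intro t n ht hn
    have hn0 : (0:ℝ) < n := by linarith
    set L := dist x (c.1 n) with hL
    have hLn1 := hL1 n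
    have hLn2 := hL2 n
    have hL0 : 0 ≤ L := dist_nonneg
    obtain ⟨g0, g1, hg⟩ := hγ n
    have hcv := (cat0_convexOn_dist (Icc (0:ℝ) 1) (convex_Icc 0 1) (fun l => γ n (l * L))
      (fun l => c.1 (l * n)) L n (by
        intro s hs u hu
        rw [hg _ ⟨mul_nonneg hs.1 hL0, by nlinarith [hs.2]⟩ _
          ⟨mul_nonneg hu.1 hL0, by nlinarith [hu.2]⟩, ← sub_mul, abs_mul, abs_of_nonneg hL0,
          mul_comm]) (by
        intro s hs u hu
        rw [c.2 _ _ (mul_nonneg hs.1 hn0.le) (mul_nonneg hu.1 hn0.le), ← sub_mul, abs_mul,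
          abs_of_nonneg hn0.le, mul_comm])).2
    have hl0 : 0 ≤ t / n := by positivity
    have hl1 : t / n ≤ 1 := by rw [div_le_one hn0]; linarith
    have h1 := hcv (show (0:ℝ) ∈ Icc (0:ℝ) 1 by simp) (show (1:ℝ) ∈ Icc (0:ℝ) 1 by simp)
      (a := 1 - t / n) (b := t / n) (by linarith) hl0 (by ring)
    simp only [smul_eq_mul, mul_zero, mul_one, zero_add, zero_mul, one_mul] at h1
    rw [g0, g1, dist_self, mul_zero, add_zero, div_mul_cancel₀ _ hn0.ne'] at h1
    have h2 : dist (γ n t) (γ n (t / n * L)) ≤ D := by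
      rw [hg t ⟨ht, by linarith⟩ _ ⟨by positivity, by nlinarith⟩]
      have : t - t / n * L = t / n * (n - L) := by field_simp
      rw [this, abs_mul, abs_of_nonneg hl0]
      have h3 : |(n:ℝ) - L| ≤ D := by rw [abs_le]; constructor <;> linarith
      nlinarith [abs_nonneg ((n:ℝ) - L)]
    have h4 : (1 - t / n) * dist x (c.1 0) ≤ D := by rw [← hD]; nlinarith
    linarith [dist_triangle (γ n t) (γ n (t / n * L)) (c.1 t)]
  have hev : ∀ t : ℝ, ∀ᶠ n : ℕ in (hyperfilter ℕ : Filter ℕ), t + D + 1 ≤ n := by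
    intro t
    have h : (hyperfilter ℕ : Filter ℕ) ≤ atTop := by
      rw [← Nat.cofinite_eq_atTop]; exact hyperfilter_le_cofinite
    exact h (tendsto_natCast_atTop_atTop.eventually_ge_atTop (t + D + 1))
  have hlim : ∀ t : ℝ, ∃ y, 0 ≤ t → Tendsto (fun n => γ n t) (hyperfilter ℕ : Filter ℕ) (nhds y) ∧
      dist y (c.1 t) ≤ 2 * D := by
    intro t
    by_cases ht : 0 ≤ t
    · have hc : IsCompact (closedBall (c.1 t) (2 * D)) := isCompact_closedBall _ _
      obtain ⟨y, hy, hyl⟩ := hc.ultrafilter_le_nhds ((hyperfilter ℕ).map (fun n => γ n t)) (by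
        rw [le_principal_iff]
        simp only [Ultrafilter.coe_map, Filter.mem_map]
        filter_upwards [hev t] with n hn
        exact hbound t n ht hn)
      exact ⟨y, fun _ => ⟨hyl, hy⟩⟩
    · exact ⟨x, fun h => absurd h ht⟩
  choose y hy using hlim
  refine ⟨⟨y, ?_⟩, ?_, ?_⟩
  · intro s t hs ht
    have h1 := (hy s hs).1.dist (hy t ht).1
    refine tendsto_nhds_unique h1 (tendsto_const_nhds.congr' ?_)
    filter_upwards [hev s, hev t] with n h2 h3
    have := hL2 n
    exact ((hγ n).2.2 s ⟨hs, by linarith⟩ t ⟨ht, by linarith⟩).symm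
  · refine tendsto_nhds_unique (hy 0 le_rfl).1 (tendsto_const_nhds.congr fun n => ?_)
    exact (hγ n).1.symm
  · exact Quotient.sound (s := raySetoid X) ⟨2 * D, fun t ht => (hy t ht).2⟩

lemma cosF_anti [CAT0 X] (c : Ray X) (p : X) (t : ℝ) (ht : 0 < t) (hp : dist p (c.1 0) = t)
    (s s' : ℝ) (hs : 0 < s) (hss : s ≤ s') :
    (s' ^ 2 + t ^ 2 - dist (c.1 s') p ^ 2) / (2 * s' * t) ≤
      (s ^ 2 + t ^ 2 - dist (c.1 s) p ^ 2) / (2 * s * t) := by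
  have hcv := (convexOn_sq (Ici (0:ℝ)) (convex_Ici 0) c.1 p
    (fun a ha b hb => c.2 a b ha hb)).2
  have hs' : 0 < s' := by linarith
  have h1 := hcv (show (0:ℝ) ∈ Ici (0:ℝ) by simp) (show s' ∈ Ici (0:ℝ) from hs'.le)
    (a := 1 - s / s') (b := s / s') (by rw [sub_nonneg, div_le_one hs']; exact hss)
    (by positivity) (by ring)
  simp only [smul_eq_mul, mul_zero, zero_add, hp, div_mul_cancel₀ _ hs'.ne'] at h1
  rw [dist_comm p, dist_comm p] at h1
  rw [div_le_div_iff₀ (by positivity) (by positivity)]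
  set A := dist (c.1 s) p ^ 2
  set A' := dist (c.1 s') p ^ 2
  have h2 : (A - s ^ 2) * s' ≤ (s' - s) * t ^ 2 + s * (A' - s' ^ 2) := by
    have := mul_le_mul_of_nonneg_right h1 hs'.le
    have e : ((1 - s / s') * (t ^ 2 - 0 ^ 2) + s / s' * (A' - s' ^ 2)) * s'
      = (s' - s) * t ^ 2 + s * (A' - s' ^ 2) := by field_simp; ring
    rwa [e] at this
  nlinarith

/-- cosine of comparison angle -/
def cosF (c c' : Ray X) (s t : ℝ) : ℝ :=
  (s ^ 2 + t ^ 2 - dist (c.1 s) (c'.1 t) ^ 2) / (2 * s * t)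

lemma ray_dist_zero (c : Ray X) (t : ℝ) (ht : 0 ≤ t) : dist (c.1 t) (c.1 0) = t := by
  rw [c.2 t 0 ht le_rfl, sub_zero, abs_of_nonneg ht]

lemma cosF_anti2 [CAT0 X] (c c' : Ray X) (h : c.1 0 = c'.1 0) (s s' t t' : ℝ) (hs : 0 < s)
    (ht : 0 < t) (hss : s ≤ s') (htt : t ≤ t') : cosF c c' s' t' ≤ cosF c c' s t := by
  have h1 := cosF_anti c (c'.1 t) t ht (by rw [h, ray_dist_zero c' t ht.le]) s s' hs hss
  have hs' : 0 < s' := by linarith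
  have h2 := cosF_anti c' (c.1 s') s' hs' (by rw [← h, ray_dist_zero c s' hs'.le]) t t' ht htt
  unfold cosF
  refine le_trans ?_ h1
  rw [dist_comm (c'.1 t'), dist_comm (c'.1 t), add_comm (t' ^ 2), add_comm (t ^ 2),
    mul_right_comm 2 t', mul_right_comm 2 t] at h2
  exact h2

lemma ray_dist_le (c c' : Ray X) (h : c.1 0 = c'.1 0) (t : ℝ) (ht : 0 ≤ t) :
    dist (c.1 t) (c'.1 t) ≤ 2 * t := by
  have h1 := dist_triangle_right (c.1 t) (c'.1 t) (c.1 0)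
  have h2 := ray_dist_zero c' t ht
  rw [← h] at h2
  rw [ray_dist_zero c t ht, h2] at h1
  linarith

lemma exists_ratio_lim [CAT0 X] (c c' : Ray X) (h : c.1 0 = c'.1 0) :
    ∃ l, 0 ≤ l ∧ l ≤ 2 ∧ Tendsto (fun t => dist (c.1 t) (c'.1 t) / t) atTop (nhds l) := by
  have hdiag : ∀ t, 0 < t → cosF c c' t t = 1 - (dist (c.1 t) (c'.1 t) / t) ^ 2 / 2 := by
    intro t ht; unfold cosF; field_simp; ring
  have hle2 : ∀ t, 0 < t → dist (c.1 t) (c'.1 t) / t ≤ 2 := by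
    intro t ht; rw [div_le_iff₀ ht]; exact ray_dist_le c c' h t ht.le
  have hge0 : ∀ t, 0 < t → 0 ≤ dist (c.1 t) (c'.1 t) / t := fun t ht => by positivity
  have hmono : Monotone (fun t : ℝ => dist (c.1 (max t 1)) (c'.1 (max t 1)) / max t 1) := by
    intro s t hst
    have hs1 : 0 < max s 1 := lt_of_lt_of_le one_pos (le_max_right _ _)
    have ht1 : 0 < max t 1 := lt_of_lt_of_le one_pos (le_max_right _ _)
    have hm : max s 1 ≤ max t 1 := max_le_max_right 1 hst
    have := cosF_anti2 c c' h _ _ _ _ hs1 hs1 hm hm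
    rw [hdiag _ hs1, hdiag _ ht1] at this
    exact le_of_sq_le_sq (by linarith) (hge0 _ ht1)
  have hbdd : BddAbove (range (fun t : ℝ => dist (c.1 (max t 1)) (c'.1 (max t 1)) / max t 1)) := by
    refine ⟨2, ?_⟩
    rintro _ ⟨t, rfl⟩
    exact hle2 _ (lt_of_lt_of_le one_pos (le_max_right _ _))
  have hlim := tendsto_atTop_ciSup hmono hbdd
  set l := ⨆ t : ℝ, dist (c.1 (max t 1)) (c'.1 (max t 1)) / max t 1
  have hlim' : Tendsto (fun t => dist (c.1 t) (c'.1 t) / t) atTop (nhds l) := by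
    refine hlim.congr' ?_
    filter_upwards [eventually_ge_atTop (1:ℝ)] with t ht
    rw [max_eq_left ht]
  refine ⟨l, ?_, ?_, hlim'⟩
  · refine ge_of_tendsto hlim' ?_
    filter_upwards [eventually_gt_atTop (0:ℝ)] with t ht using hge0 t ht
  · refine le_of_tendsto hlim' ?_
    filter_upwards [eventually_gt_atTop (0:ℝ)] with t ht using hle2 t ht

lemma ratio_lim_congr (c c' d d' : Ray X) (h : rayClass c = rayClass d)
    (h' : rayClass c' = rayClass d') (l : ℝ)
    (hl : Tendsto (fun t => dist (c.1 t) (c'.1 t) / t) atTop (nhds l)) :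
    Tendsto (fun t => dist (d.1 t) (d'.1 t) / t) atTop (nhds l) := by
  obtain ⟨K, hK⟩ : asymptotic c d := Quotient.exact (s := raySetoid X) h
  obtain ⟨K', hK'⟩ : asymptotic c' d' := Quotient.exact (s := raySetoid X) h'
  have hz : Tendsto (fun t : ℝ => (K + K') / t) atTop (nhds 0) :=
    tendsto_const_nhds.div_atTop tendsto_id
  have hdiff : Tendsto (fun t => dist (d.1 t) (d'.1 t) / t - dist (c.1 t) (c'.1 t) / t) atTop
      (nhds 0) := by
    refine squeeze_zero_norm' ?_ hz
    filter_upwards [eventually_gt_atTop (0:ℝ)] with t ht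
    rw [← sub_div, Real.norm_eq_abs, abs_div, abs_of_pos ht]
    apply div_le_div_of_nonneg_right _ ht.le
    have h1 := hK t ht.le
    have h2 := hK' t ht.le
    have h3 := dist_triangle4 (d.1 t) (c.1 t) (c'.1 t) (d'.1 t)
    have h4 := dist_triangle4 (c.1 t) (d.1 t) (d'.1 t) (c'.1 t)
    rw [dist_comm (d.1 t) (c.1 t)] at h3
    rw [dist_comm (d'.1 t) (c'.1 t)] at h4
    rw [abs_le]; constructor <;> linarith
  have := hdiff.add hl
  simpa using this

lemma tits_spec [CAT0 X] [ProperSpace X] (ξ η : IdealBoundary X) :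
    0 ≤ titsAngle ξ η ∧ titsAngle ξ η ≤ π ∧ ∀ c c' : Ray X, rayClass c = ξ → rayClass c' = η →
      Tendsto (fun t => dist (c.1 t) (c'.1 t) / t) atTop (nhds (2 * sin (titsAngle ξ η / 2))) := by
  obtain ⟨c0, hc0⟩ : ∃ c : Ray X, rayClass c = ξ := Quotient.exists_rep ξ
  obtain ⟨c1', hc1'⟩ : ∃ c : Ray X, rayClass c = η := Quotient.exists_rep η
  obtain ⟨c1, hb, hc1⟩ := exists_ray_from c1' (c0.1 0)
  rw [hc1'] at hc1
  obtain ⟨l, hl0, hl2, hl⟩ := exists_ratio_lim c0 c1 hb.symm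
  have hall : ∀ c c' : Ray X, rayClass c = ξ → rayClass c' = η →
      Tendsto (fun t => dist (c.1 t) (c'.1 t) / t) atTop (nhds l) := by
    intro c c' h h'
    exact ratio_lim_congr c0 c1 c c' (by rw [hc0, h]) (by rw [hc1, h']) l hl
  have harc : ∀ c c' : Ray X, rayClass c = ξ → rayClass c' = η →
      Tendsto (fun t : ℝ => 2 * Real.arcsin (dist (c.1 t) (c'.1 t) / (2 * t))) atTop
        (nhds (2 * Real.arcsin (l / 2))) := by
    intro c c' h h'
    have h1 := (hall c c' h h').div_const 2
    have h2 := ((Real.continuous_arcsin.tendsto _).comp h1).const_mul 2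
    refine h2.congr fun t => ?_
    simp only [Function.comp]
    rw [div_div, mul_comm t 2]
  have hset : {θ : ℝ | ∃ c c' : Ray X, rayClass c = ξ ∧ rayClass c' = η ∧ c.1 0 = c'.1 0 ∧
      Tendsto (fun t : ℝ => 2 * Real.arcsin (dist (c.1 t) (c'.1 t) / (2 * t)))
        atTop (nhds θ)} = {2 * Real.arcsin (l / 2)} := by
    ext θ
    simp only [mem_ofPred_eq, mem_singleton_iff]
    constructor
    · rintro ⟨c, c', h, h', _, ht⟩
      exact tendsto_nhds_unique ht (harc c c' h h')
    · rintro rfl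
      exact ⟨c0, c1, hc0, hc1, hb.symm, harc c0 c1 hc0 hc1⟩
  have hθ : titsAngle ξ η = 2 * Real.arcsin (l / 2) := by
    unfold titsAngle
    rw [hset, csSup_singleton]
  rw [hθ]
  refine ⟨?_, ?_, ?_⟩
  · have := Real.arcsin_nonneg.2 (show 0 ≤ l / 2 by linarith)
    linarith
  · linarith [Real.arcsin_le_pi_div_two (l / 2)]
  · rw [mul_div_cancel_left₀ _ (two_ne_zero), Real.sin_arcsin (by linarith) (by linarith),
      mul_div_cancel₀ _ (two_ne_zero)]
    exact hall

lemma cone_lim [CAT0 X] [ProperSpace X] (c c' : Ray X) (h : c.1 0 = c'.1 0) (s t : ℝ)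
    (hs : 0 < s) (ht : 0 < t) :
    Tendsto (fun r => dist (c.1 (s * r)) (c'.1 (t * r)) / r) atTop
      (nhds (√(s ^ 2 + t ^ 2 - 2 * s * t * cos (titsAngle (rayClass c) (rayClass c'))))) := by
  set θ := titsAngle (rayClass c) (rayClass c')
  have h0 := (tits_spec (rayClass c) (rayClass c')).2.2 c c' rfl rfl
  have hcos : Tendsto (fun r => cosF c c' r r) atTop (nhds (cos θ)) := by
    have h1 := ((h0.pow 2).div_const 2).const_sub 1
    have e : 1 - (2 * sin (θ / 2)) ^ 2 / 2 = cos θ := by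
      have := Real.cos_two_mul (θ / 2)
      rw [mul_div_cancel₀ _ (two_ne_zero)] at this
      rw [this, mul_pow, Real.sin_sq]; ring
    rw [e] at h1
    refine h1.congr' ?_
    filter_upwards [eventually_gt_atTop (0:ℝ)] with r hr
    unfold cosF; field_simp; ring
  set u := min s t
  set v := max s t
  have hu : 0 < u := lt_min hs ht
  have hv : 0 < v := lt_of_lt_of_le hs (le_max_left _ _)
  have hF : Tendsto (fun r => cosF c c' (s * r) (t * r)) atTop (nhds (cos θ)) := by
    refine tendsto_of_tendsto_of_tendsto_of_le_of_le'
      (hcos.comp (tendsto_id.const_mul_atTop hv)) (hcos.comp (tendsto_id.const_mul_atTop hu)) ?_ ?_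
    · filter_upwards [eventually_gt_atTop (0:ℝ)] with r hr
      exact cosF_anti2 c c' h _ _ _ _ (by positivity) (by positivity)
        (mul_le_mul_of_nonneg_right (le_max_left _ _) hr.le)
        (mul_le_mul_of_nonneg_right (le_max_right _ _) hr.le)
    · filter_upwards [eventually_gt_atTop (0:ℝ)] with r hr
      exact cosF_anti2 c c' h _ _ _ _ (by simp only [id]; positivity) (by simp only [id]; positivity)
        (mul_le_mul_of_nonneg_right (min_le_left _ _) hr.le)
        (mul_le_mul_of_nonneg_right (min_le_right _ _) hr.le)
  have h2 := ((hF.const_mul (2 * s * t)).const_sub (s ^ 2 + t ^ 2)).sqrt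
  refine h2.congr' ?_
  filter_upwards [eventually_gt_atTop (0:ℝ)] with r hr
  rw [show s ^ 2 + t ^ 2 - 2 * s * t * cosF c c' (s * r) (t * r)
    = (dist (c.1 (s * r)) (c'.1 (t * r)) / r) ^ 2 by unfold cosF; field_simp; ring]
  exact Real.sqrt_sq (by positivity)

lemma tits_triangle [CAT0 X] [ProperSpace X] (ξ η ζ : IdealBoundary X) :
    titsAngle ξ ζ ≤ titsAngle ξ η + titsAngle η ζ := by
  obtain ⟨c0, hc0⟩ : ∃ c : Ray X, rayClass c = ξ := Quotient.exists_rep ξ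
  obtain ⟨c1', hc1'⟩ : ∃ c : Ray X, rayClass c = η := Quotient.exists_rep η
  obtain ⟨c2', hc2'⟩ : ∃ c : Ray X, rayClass c = ζ := Quotient.exists_rep ζ
  obtain ⟨c1, hb1, hc1⟩ := exists_ray_from c1' (c0.1 0)
  obtain ⟨c2, hb2, hc2⟩ := exists_ray_from c2' (c0.1 0)
  rw [hc1'] at hc1
  rw [hc2'] at hc2
  obtain ⟨ha0, haπ, _⟩ := tits_spec ξ η
  obtain ⟨hb0, hbπ, _⟩ := tits_spec η ζ
  obtain ⟨hd0, hdπ, hdlim⟩ := tits_spec ξ ζ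
  set a := titsAngle ξ η with ha
  set b := titsAngle η ζ with hb
  set d := titsAngle ξ ζ
  by_contra! hlt
  have habπ : a + b < π := by linarith
  -- cone distances
  have hcone : ∀ ρ : ℝ, 0 < ρ → 2 * sin (d / 2) ≤
      √(1 ^ 2 + ρ ^ 2 - 2 * 1 * ρ * cos a) + √(ρ ^ 2 + 1 ^ 2 - 2 * ρ * 1 * cos b) := by
    intro ρ hρ
    have l1 := cone_lim c0 c1 hb1.symm 1 ρ one_pos hρ
    have l2 := cone_lim c1 c2 (hb1.trans hb2.symm) ρ 1 hρ one_pos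
    rw [hc0, hc1, ← ha] at l1
    rw [hc1, hc2, ← hb] at l2
    refine le_of_tendsto_of_tendsto (hdlim c0 c2 hc0 hc2) (l1.add l2) ?_
    filter_upwards [eventually_gt_atTop (0:ℝ)] with r hr
    rw [one_mul, ← add_div]
    exact div_le_div_of_nonneg_right (dist_triangle _ _ _) hr.le
  have hgoal : 2 * sin (d / 2) ≤ 2 * sin ((a + b) / 2) := by
    have hS0 : 0 ≤ sin ((a + b) / 2) := sin_nonneg_of_nonneg_of_le_pi (by linarith) (by linarith)
    have hC : (2 * sin ((a + b) / 2)) ^ 2 = 2 - 2 * cos (a + b) := by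
      have := Real.cos_two_mul ((a + b) / 2)
      rw [mul_div_cancel₀ _ (two_ne_zero)] at this
      rw [this, mul_pow, Real.sin_sq]; ring
    by_cases hz : a + b = 0
    · have a0 : a = 0 := by linarith
      have b0 : b = 0 := by linarith
      have := hcone 1 one_pos
      rw [a0, b0] at this ⊢
      norm_num at this ⊢
      exact this
    · have hpos : 0 < a + b := lt_of_le_of_ne (by linarith) (Ne.symm hz)
      have hsa : 0 ≤ sin a := sin_nonneg_of_nonneg_of_le_pi ha0 haπ
      have hsb : 0 ≤ sin b := sin_nonneg_of_nonneg_of_le_pi hb0 hbπ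
      have hsab : 0 < sin (a + b) := sin_pos_of_pos_of_lt_pi hpos habπ
      have hσ : 0 < sin a + sin b := by
        rcases ha0.eq_or_lt with h | h
        · have : 0 < sin b := sin_pos_of_pos_of_lt_pi (by linarith) (by linarith)
          linarith
        · have : 0 < sin a := sin_pos_of_pos_of_lt_pi h (by linarith)
          linarith
      have h1 := hcone (sin (a + b) / (sin a + sin b)) (by positivity)
      set S := 2 * sin ((a + b) / 2) with hS
      have hS0' : 0 ≤ S := by positivity
      have pa := Real.sin_sq_add_cos_sq a
      have pb := Real.sin_sq_add_cos_sq b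
      have e1 : 1 ^ 2 + (sin (a + b) / (sin a + sin b)) ^ 2
          - 2 * 1 * (sin (a + b) / (sin a + sin b)) * cos a
          = (sin a / (sin a + sin b) * S) ^ 2 := by
        rw [mul_pow, hC, Real.sin_add, Real.cos_add]
        field_simp
        have ca : cos a ^ 2 = 1 - sin a ^ 2 := by linarith
        have cb : cos b ^ 2 = 1 - sin b ^ 2 := by linarith
        ring_nf
        simp only [ca, cb, show cos a ^ 3 = cos a * cos a ^ 2 by ring]
        ring
      have e2 : (sin (a + b) / (sin a + sin b)) ^ 2 + 1 ^ 2
          - 2 * (sin (a + b) / (sin a + sin b)) * 1 * cos b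
          = (sin b / (sin a + sin b) * S) ^ 2 := by
        rw [mul_pow, hC, Real.sin_add, Real.cos_add]
        field_simp
        have ca : cos a ^ 2 = 1 - sin a ^ 2 := by linarith
        have cb : cos b ^ 2 = 1 - sin b ^ 2 := by linarith
        ring_nf
        simp only [ca, cb, show cos a ^ 3 = cos a * cos a ^ 2 by ring]
        ring
      rw [e1, e2, Real.sqrt_sq (by positivity), Real.sqrt_sq (by positivity), ← add_mul, ← add_div,
        div_self hσ.ne', one_mul] at h1
      exact h1
  have hlt2 : sin ((a + b) / 2) < sin (d / 2) :=
    Real.sin_lt_sin_of_lt_of_le_pi_div_two (by linarith [Real.pi_pos]) (by linarith) (by linarith)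
  linarith

lemma tits_self [CAT0 X] [ProperSpace X] (ξ : IdealBoundary X) : titsAngle ξ ξ = 0 := by
  obtain ⟨c, hc⟩ : ∃ c : Ray X, rayClass c = ξ := Quotient.exists_rep ξ
  obtain ⟨h0, hπ, hl⟩ := tits_spec ξ ξ
  have h1 := hl c c hc hc
  simp only [dist_self, zero_div] at h1
  have h2 := tendsto_nhds_unique h1 tendsto_const_nhds
  by_contra hne
  have hpos : 0 < titsAngle ξ ξ := lt_of_le_of_ne h0 (Ne.symm hne)
  have : 0 < sin (titsAngle ξ ξ / 2) := sin_pos_of_pos_of_lt_pi (by linarith)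
    (by linarith [Real.pi_pos])
  linarith

lemma tits_chain [CAT0 X] [ProperSpace X] (f : ℕ → IdealBoundary X) (n : ℕ) :
    ENNReal.ofReal (titsAngle (f 0) (f n)) ≤ chainLength f n := by
  induction n with
  | zero => simp [tits_self]
  | succ n ih =>
    unfold chainLength at ih ⊢
    rw [Finset.sum_range_succ]
    refine le_trans (ENNReal.ofReal_le_ofReal (tits_triangle (f 0) (f n) (f (n + 1)))) ?_
    refine le_trans ENNReal.ofReal_add_le ?_
    gcongr

lemma tits_le_dist [CAT0 X] [ProperSpace X] (ξ η : IdealBoundary X) :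
    ENNReal.ofReal (titsAngle ξ η) ≤ titsDist ξ η := by
  unfold titsDist
  refine le_trans ?_ (le_iSup₂ (1:ℝ) one_pos)
  apply le_sInf
  rintro L ⟨n, f, rfl, rfl, _, rfl⟩
  exact tits_chain f n

lemma antipodal_of_line [CAT0 X] [ProperSpace X] (c : ℝ → X) (h : IsGeodesicLine c) :
    AntipodalB (rayClass (linePosRay c h)) (rayClass (lineNegRay c h)) := by
  refine le_trans ?_ (tits_le_dist _ _)
  obtain ⟨h0, hπ, hl⟩ := tits_spec (rayClass (linePosRay c h)) (rayClass (lineNegRay c h))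
  have h1 := hl _ _ rfl rfl
  set θ := titsAngle (rayClass (linePosRay c h)) (rayClass (lineNegRay c h))
  have h2 : 2 * sin (θ / 2) = 2 := by
    refine tendsto_nhds_unique h1 (tendsto_const_nhds.congr' ?_)
    filter_upwards [eventually_gt_atTop (0:ℝ)] with t ht
    simp only [linePosRay, lineNegRay]
    rw [h, sub_neg_eq_add, abs_of_pos (by linarith)]
    field_simp; ring
  have h3 : θ = π := by
    by_contra hne
    have : θ < π := lt_of_le_of_ne hπ hne
    have := Real.sin_lt_sin_of_lt_of_le_pi_div_two (x := θ / 2) (y := π / 2)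
      (by linarith [Real.pi_pos]) le_rfl (by linarith)
    rw [Real.sin_pi_div_two] at this
    linarith
  rw [h3]

lemma extend_ray [CAT0 X] (hgc : GeodesicallyComplete X) (c : Ray X) :
    ∃ (e : ℝ → X) (h : IsGeodesicLine e), e 0 = c.1 0 ∧ rayClass (linePosRay e h) = rayClass c := by
  have hd1 : dist (c.1 0) (c.1 1) = 1 := by rw [dist_comm, ray_dist_zero c 1 zero_le_one]
  obtain ⟨k, hk, hkc⟩ := hgc c.1 (c.1 0) (c.1 1)
    ⟨rfl, by rw [hd1], fun s hs t ht => c.2 s t hs.1 ht.1⟩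
    (by intro h; rw [h, dist_self] at hd1; norm_num at hd1)
  rw [hd1] at hkc
  have hk0 : k 0 = c.1 0 := hkc 0 (by simp)
  have hk1 : k 1 = c.1 1 := hkc 1 (by simp)
  have key : ∀ s t : ℝ, s ≤ 0 → 0 ≤ t → dist (k s) (c.1 t) = t - s := by
    intro s t hs ht
    have hup : dist (k s) (c.1 t) ≤ t - s := by
      have h1 := dist_triangle (k s) (k 0) (c.1 t)
      have h2 := ray_dist_zero c t ht
      rw [hk s 0, hk0, dist_comm (c.1 0), h2, sub_zero, abs_of_nonpos hs] at h1
      linarith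
    rcases le_total t 1 with h | h
    · rw [← hkc t ⟨ht, h⟩, hk, abs_of_nonpos (by linarith)]; ring
    · apply le_antisymm hup
      have hcv := (convexOn_sq (Ici (0:ℝ)) (convex_Ici 0) c.1 (k s)
        (fun a ha b hb => c.2 a b ha hb)).2
      have ht0 : 0 < t := by linarith
      have h1 := hcv (show (0:ℝ) ∈ Ici (0:ℝ) by simp) (show t ∈ Ici (0:ℝ) from ht)
        (a := 1 - 1 / t) (b := 1 / t) (by rw [sub_nonneg, div_le_one ht0]; exact h)
        (by positivity) (by ring)
      simp only [smul_eq_mul, mul_zero, zero_add, div_mul_cancel₀ _ ht0.ne'] at h1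
      rw [← hk0, ← hk1, hk, hk, sq_abs, sq_abs] at h1
      have h2 := mul_le_mul_of_nonneg_right h1 ht
      have e : ((1 - 1 / t) * ((s - 0) ^ 2 - 0 ^ 2) + 1 / t * (dist (k s) (c.1 t) ^ 2 - t ^ 2)) * t
        = (t - 1) * s ^ 2 + (dist (k s) (c.1 t) ^ 2 - t ^ 2) := by field_simp; ring
      rw [e] at h2
      apply le_of_sq_le_sq _ dist_nonneg
      nlinarith
  let e : ℝ → X := fun t => if t ≤ 0 then k t else c.1 t
  have he1 : ∀ t, t ≤ 0 → e t = k t := fun t ht => if_pos ht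
  have he2 : ∀ t, 0 ≤ t → e t = c.1 t := by
    intro t ht
    rcases ht.eq_or_lt with h | h
    · rw [← h, he1 0 le_rfl, hk0]
    · exact if_neg (not_le.2 h)
  have he : IsGeodesicLine e := by
    intro s t
    rcases le_total s 0 with hs | hs <;> rcases le_total t 0 with ht | ht
    · rw [he1 s hs, he1 t ht, hk]
    · rw [he1 s hs, he2 t ht, key s t hs ht, abs_of_nonpos (by linarith)]; ring
    · rw [he2 s hs, he1 t ht, dist_comm, key t s ht hs, abs_of_nonneg (by linarith)]
    · rw [he2 s hs, he2 t ht, c.2 s t hs ht]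
  refine ⟨e, he, he2 0 le_rfl, Quotient.sound (s := raySetoid X) ⟨0, fun t ht => ?_⟩⟩
  simp only [linePosRay]
  rw [he2 t ht, dist_self]

lemma line_dist_const [CAT0 X] (c c' : ℝ → X) (h : IsGeodesicLine c) (h' : IsGeodesicLine c')
    (hp : rayClass (linePosRay c h) = rayClass (linePosRay c' h'))
    (hn : rayClass (lineNegRay c h) = rayClass (lineNegRay c' h')) (s t : ℝ) :
    dist (c s) (c' s) = dist (c t) (c' t) := by
  obtain ⟨K, hK⟩ : asymptotic _ _ := Quotient.exact (s := raySetoid X) hp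
  obtain ⟨K', hK'⟩ : asymptotic _ _ := Quotient.exact (s := raySetoid X) hn
  simp only [linePosRay, lineNegRay] at hK hK'
  have hb : ∀ t, dist (c t) (c' t) ≤ max K K' := by
    intro t
    rcases le_total 0 t with ht | ht
    · exact (hK t ht).trans (le_max_left _ _)
    · have := hK' (-t) (by linarith)
      rw [neg_neg] at this
      exact this.trans (le_max_right _ _)
  have hcv := (cat0_convexOn_dist univ convex_univ c c' 1 1 (by intro s _ t _; rw [h]; ring)
    (by intro s _ t _; rw [h']; ring)).2
  have main : ∀ a b, dist (c b) (c' b) ≤ dist (c a) (c' a) := by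
    intro a b
    by_contra! hlt
    set M := max K K'
    have hM : 0 ≤ M := dist_nonneg.trans (hb 0)
    set δ := dist (c b) (c' b) - dist (c a) (c' a) with hδ
    have hδ0 : 0 < δ := by linarith
    set N := (M + 1) / δ + 1 with hN
    have hN1 : 1 ≤ N := by rw [hN]; have : 0 ≤ (M + 1) / δ := by positivity
                           linarith
    have h1 := hcv (mem_univ a) (mem_univ (a + N * (b - a))) (a := 1 - 1 / N) (b := 1 / N)
      (by rw [sub_nonneg, div_le_one (by linarith)]; exact hN1) (by positivity) (by ring)
    simp only [smul_eq_mul] at h1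
    have hN0 : N ≠ 0 := by linarith
    rw [show (1 - 1 / N) * a + 1 / N * (a + N * (b - a)) = b by field_simp; ring] at h1
    have h2 := hb (a + N * (b - a))
    have hA : 0 ≤ dist (c a) (c' a) := dist_nonneg
    have h3 : δ * N ≤ M := by
      have h4 := mul_le_mul_of_nonneg_right h1 (show 0 ≤ N by linarith)
      have e : ((1 - 1 / N) * dist (c a) (c' a) + 1 / N * dist (c (a + N * (b - a)))
        (c' (a + N * (b - a)))) * N = (N - 1) * dist (c a) (c' a) +
          dist (c (a + N * (b - a))) (c' (a + N * (b - a))) := by field_simp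
      rw [e] at h4
      rw [hδ]; nlinarith
    have h5 : δ * N = M + 1 + δ := by rw [hN]; field_simp
    linarith
  exact le_antisymm (main t s) (main s t)

lemma shift_line (c : ℝ → X) (h : IsGeodesicLine c) (a : ℝ) :
    ∃ h' : IsGeodesicLine (fun t => c (t + a)),
      rayClass (linePosRay _ h') = rayClass (linePosRay c h) ∧
      rayClass (lineNegRay _ h') = rayClass (lineNegRay c h) := by
  have h' : IsGeodesicLine (fun t => c (t + a)) := by
    intro s t
    rw [h]; congr 1; ring
  refine ⟨h', Quotient.sound (s := raySetoid X) ⟨|a|, fun t _ => ?_⟩,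
    Quotient.sound (s := raySetoid X) ⟨|a|, fun t _ => ?_⟩⟩
  · simp only [linePosRay]
    rw [h, add_sub_cancel_left]
  · simp only [lineNegRay]
    rw [h, add_sub_cancel_left]

/-- Let `X` be a locally compact, geodesically complete CAT(0) space whose Tits
boundary `Z = ∂_T X` is a CAT(1) space of diameter `π` in which every point has an
antipode, and suppose there are ideal points `ξ, ξ̂` which are each other's unique
antipodes.  Then `X` splits off a line: `X` is isometric to `ℝ × X'` (with the
Pythagorean product metric) for some CAT(0) space `X'`. -/
theorem splits_off_line_of_unique_antipodes
    {X : Type*} [MetricSpace X] [CAT0 X] [LocallyCompactSpace X] [CompleteSpace X]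
    (hgc : GeodesicallyComplete X)
    -- the Tits boundary has diameter at most π
    (hdiam : ∀ ζ η : IdealBoundary X, titsDist ζ η ≤ ENNReal.ofReal π)
    -- every point of the Tits boundary has an antipode
    (hant : ∀ ζ : IdealBoundary X, ∃ η : IdealBoundary X, AntipodalB ζ η)
    (ξ ξhat : IdealBoundary X) (hξ : AntipodalB ξ ξhat)
    (huniq₁ : ∀ η : IdealBoundary X, AntipodalB ξ η → η = ξhat)
    (huniq₂ : ∀ η : IdealBoundary X, AntipodalB ξhat η → η = ξ) :
    ∃ (X' : Type) (_ : MetricSpace X') (_ : CAT0 X') (f : X → ℝ × X'),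
      Function.Bijective f ∧
        ∀ x y : X, dist x y ^ 2 =
          (dist (f x).1 (f y).1) ^ 2 + (dist (f x).2 (f y).2) ^ 2 := by
  classical
  haveI : ProperSpace X := cat0_proper
  haveI : Small.{0} X := small_of_proper
  obtain ⟨c0, hc0⟩ : ∃ c : Ray X, rayClass c = ξ := Quotient.exists_rep ξ
  haveI : Nonempty X := ⟨c0.1 0⟩
  have hlines : ∀ x : X, ∃ (e : ℝ → X) (h : IsGeodesicLine e), e 0 = x ∧
      rayClass (linePosRay e h) = ξ ∧ rayClass (lineNegRay e h) = ξhat := by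
    intro x
    obtain ⟨c, hcx, hc⟩ := exists_ray_from c0 x
    obtain ⟨e, he, he0, hep⟩ := extend_ray hgc c
    have hξe : rayClass (linePosRay e he) = ξ := by rw [hep, hc, hc0]
    refine ⟨e, he, he0.trans hcx, hξe, ?_⟩
    apply huniq₁
    rw [← hξe]
    exact antipodal_of_line e he
  choose L hL hL0 hLp hLn using hlines
  have hshift : ∀ x t a, L (L x a) t = L x (t + a) := by
    intro x t a
    obtain ⟨h', hp, hn⟩ := shift_line (L x) (hL x) a
    have := line_dist_const (L (L x a)) (fun t => L x (t + a)) (hL _) h'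
      (by rw [hp, hLp, hLp]) (by rw [hn, hLn, hLn]) t 0
    simp only [zero_add, hL0, dist_self] at this
    exact dist_eq_zero.1 this
  refine split_of_flow (fun t x => L x t) hL0 ?_ ?_ ?_
  · intro s t x
    exact (hshift x s t).symm
  · intro t x y
    have := line_dist_const (L x) (L y) (hL x) (hL y) (by rw [hLp, hLp]) (by rw [hLn, hLn]) t 0
    rw [this, hL0, hL0]
  · intro t x
    have := hL x 0 t
    rw [hL0, zero_sub, abs_neg] at this
    exact this
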